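/- arXiv:1705.05042 — 3 statements merged into one kernel-verified Lean document; each statement's English description precedes it below -/
import Mathlib

section
/- Let (R, m) be a commutative Noetherian local ring, let I be an m-primary ideal of R, let l > 0 be an integer, and let x ∈ I \ I² be a nonzerodivisor of R. Assume that for every 1 ≤ i ≤ l the R/I-module I^i/I^{i+1} is free and the map I^{i-1}/I^i → I^i/I^{i+1} induced by multiplication by x is injective (with the convention I^0 = R). Then for every 1 ≤ i ≤ l there is an isomorphism of R-modules I^i/xI^i ≅ (I^{i-1}/I^i) ⊕ (I^i/xI^{i-1}). -/
open scoped TensorProduct in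
/-- Over a local ring of depth zero, every injective map between finite free modules splits. -/
theorem exists_leftInverse_of_injective_of_socle {A M N : Type*} [CommRing A] [IsLocalRing A]
    [AddCommGroup M] [Module A M] [Module.Finite A M] [Module.Free A M]
    [AddCommGroup N] [Module A N] [Module.Finite A N] [Module.Free A N]
    {s : A} (hs : s ≠ 0) (hsm : ∀ a ∈ IsLocalRing.maximalIdeal A, a * s = 0)
    (f : M →ₗ[A] N) (hf : Function.Injective f) :
    ∃ g : N →ₗ[A] M, g ∘ₗ f = LinearMap.id := by
  rw [IsLocalRing.split_injective_iff_lTensor_residueField_injective]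
  set m := IsLocalRing.maximalIdeal A
  suffices h : Function.Injective (f.lTensor (A ⧸ m)) from h
  rw [← LinearMap.ker_eq_bot, LinearMap.ker_eq_bot']
  intro t ht
  obtain ⟨y, hy⟩ := Submodule.Quotient.mk_surjective _ (TensorProduct.quotTensorEquivQuotSMul M m t)
  obtain rfl : t = (1 : A ⧸ m) ⊗ₜ[A] y := by
    rw [← LinearEquiv.symm_apply_eq] at hy
    exact hy.symm.trans (TensorProduct.quotTensorEquivQuotSMul_symm_mk m y)
  have ht' : f y ∈ (m • ⊤ : Submodule A N) := by
    rw [← Submodule.Quotient.mk_eq_zero, ← TensorProduct.quotTensorEquivQuotSMul_mk_one_tmul,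
      LinearEquiv.map_eq_zero_iff]
    exact ht
  have hsfy : s • f y = 0 := by
    refine Submodule.smul_induction_on ht' (fun a ha n _ => ?_) fun n n' h h' => ?_
    · rw [smul_smul, mul_comm, hsm a ha, zero_smul]
    · rw [smul_add, h, h', add_zero]
  have hsy : s • y = 0 := hf (by rw [map_smul, hsfy, map_zero])
  have hy' : y ∈ (m • ⊤ : Submodule A M) := by
    let b := Module.Free.chooseBasis A M
    rw [← b.sum_repr y]
    refine Submodule.sum_mem _ fun j _ => Submodule.smul_mem_smul ?_ trivial
    rw [IsLocalRing.mem_maximalIdeal, mem_nonunits_iff]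
    intro hu
    have : s * b.repr y j = 0 := by
      simpa using congrArg (fun z => b.repr z j) hsy
    exact hs ((hu.mul_left_eq_zero).mp this)
  rwa [← LinearEquiv.map_eq_zero_iff (TensorProduct.quotTensorEquivQuotSMul M m),
    TensorProduct.quotTensorEquivQuotSMul_mk_one_tmul, Submodule.Quotient.mk_eq_zero]

/-- The quotient of a Noetherian local ring by an `m`-primary ideal has nonzero socle. -/
theorem exists_socle_of_radical_eq_maximalIdeal {R : Type*} [CommRing R] [IsNoetherianRing R]
    [IsLocalRing R] {I : Ideal R} (hI : I.radical = IsLocalRing.maximalIdeal R) :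
    ∃ s : R, s ∉ I ∧ ∀ a ∈ IsLocalRing.maximalIdeal R, a * s ∈ I := by
  have hne : I ≠ ⊤ := by
    rintro rfl
    exact (IsLocalRing.maximalIdeal.isMaximal R).ne_top (by rw [← hI, Ideal.radical_top])
  have : Nontrivial (R ⧸ I) := Ideal.Quotient.nontrivial_iff.mpr hne
  obtain ⟨p, hp⟩ := associatedPrimes.nonempty R (R ⧸ I)
  obtain ⟨hprime, z, hz⟩ := Submodule.isAssociatedPrime_iff.mp hp
  obtain ⟨s, rfl⟩ := Ideal.Quotient.mk_surjective z
  have key : ∀ a, a ∈ p ↔ a * s ∈ I := fun a => by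
    rw [hz, Submodule.mem_colon_singleton, Submodule.mem_bot, Algebra.smul_def,
      Ideal.Quotient.algebraMap_eq, ← map_mul, Ideal.Quotient.eq_zero_iff_mem]
  refine ⟨s, fun h => hprime.ne_top ?_, fun a ha => ?_⟩
  · rw [Ideal.eq_top_iff_one, key, one_mul]
    exact h
  · rw [← hI] at ha
    exact (key a).mp (hprime.radical_le_iff.mpr
      (fun b hb => (key b).mpr (I.mul_mem_right s hb)) ha)

/-- A free module stays free after reduction modulo an ideal. -/
theorem free_quotient_smul_top {R M : Type*} [CommRing R] [AddCommGroup M] [Module R M]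
    [Module.Free R M] (I : Ideal R) : Module.Free (R ⧸ I) (M ⧸ (I • ⊤ : Submodule R M)) :=
  Module.Free.of_equiv ((TensorProduct.quotTensorEquivQuotSMul M I).extendScalarsOfSurjective
    (R := R) (S := R ⧸ I) Ideal.Quotient.mk_surjective)

/-- Membership in `I • ⊤` inside `I ^ n` means membership in `I ^ (n + 1)`. -/
theorem mem_smul_top_pow_iff {R : Type*} [CommRing R] (I : Ideal R) (n : ℕ) (b : ↥(I ^ n)) :
    b ∈ (I • ⊤ : Submodule R ↥(I ^ n)) ↔ (b : R) ∈ I ^ (n + 1) := by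
  rw [Submodule.mem_smul_top_iff, smul_eq_mul, ← pow_succ']

/-- A map `g` on `N` retracting, modulo `K`, an injection `f : M → N` splits
the extension of `N / f(M)` by `M / K`. -/
theorem nonempty_quotient_equiv_prod {R M N : Type*} [CommRing R] [AddCommGroup M] [Module R M]
    [AddCommGroup N] [Module R N] (K : Submodule R M) (L P : Submodule R N) (f : M →ₗ[R] N)
    (hL : L = K.map f) (hP : P = LinearMap.range f) (g : N →ₗ[R] M ⧸ K)
    (hg : ∀ a, g (f a) = K.mkQ a) :
    Nonempty ((N ⧸ L) ≃ₗ[R] (M ⧸ K) × (N ⧸ P)) := by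
  let φ : N →ₗ[R] (M ⧸ K) × (N ⧸ P) := g.prod P.mkQ
  have hker : LinearMap.ker φ = L := by
    ext b
    rw [LinearMap.mem_ker, hL, LinearMap.prod_apply, Function.prod_apply, Prod.mk_eq_zero,
      Submodule.mkQ_apply, Submodule.Quotient.mk_eq_zero, hP]
    constructor
    · rintro ⟨h, a, rfl⟩
      rw [hg, Submodule.mkQ_apply, Submodule.Quotient.mk_eq_zero] at h
      exact ⟨a, h, rfl⟩
    · rintro ⟨a, ha, rfl⟩
      exact ⟨by rwa [hg, Submodule.mkQ_apply, Submodule.Quotient.mk_eq_zero], a, rfl⟩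
  have hsurj : Function.Surjective φ := by
    rintro ⟨u, v⟩
    obtain ⟨b, rfl⟩ := P.mkQ_surjective v
    obtain ⟨a, ha⟩ := K.mkQ_surjective (u - g b)
    refine ⟨b + f a, Prod.ext ?_ ?_⟩
    · change g (b + f a) = u
      rw [map_add, hg, ha, add_sub_cancel]
    · change P.mkQ (b + f a) = P.mkQ b
      rw [map_add, add_eq_left, Submodule.mkQ_apply, Submodule.Quotient.mk_eq_zero, hP]
      exact ⟨a, rfl⟩
  exact ⟨(Submodule.quotEquivOfEq _ _ hker.symm).trans (φ.quotKerEquivOfSurjective hsurj)⟩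


/-- Lemma 2.3(3) of the paper.
Let `(R, m)` be a commutative Noetherian local ring, `I` an `m`-primary ideal,
`l > 0`, and `x ∈ I \ I²` a nonzerodivisor of `R`.  Assume that for every
`1 ≤ i ≤ l` the `R/I`-module `Iⁱ/Iⁱ⁺¹` is free and the map
`Iⁱ⁻¹/Iⁱ → Iⁱ/Iⁱ⁺¹` induced by multiplication by `x` is injective
(elementwise: `a ∈ Iⁱ⁻¹` with `x·a ∈ Iⁱ⁺¹` implies `a ∈ Iⁱ`).
Then for every `1 ≤ i ≤ l` there is an isomorphism of `R`-modules
`Iⁱ/x·Iⁱ ≅ (Iⁱ⁻¹/Iⁱ) ⊕ (Iⁱ/x·Iⁱ⁻¹)`. -/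
theorem stmt2 {R : Type*} [CommRing R] [IsNoetherianRing R] [IsLocalRing R]
    (I : Ideal R) (hprim : I.radical = IsLocalRing.maximalIdeal R)
    (l : ℕ) (hl : 0 < l)
    (x : R) (hxI : x ∈ I) (hxI2 : x ∉ I ^ 2) (hx : x ∈ nonZeroDivisors R)
    (hfree : ∀ i : ℕ, 1 ≤ i → i ≤ l →
      Module.Free (R ⧸ I) (↥(I ^ i) ⧸ (I • ⊤ : Submodule R ↥(I ^ i))))
    (hinj : ∀ i : ℕ, 1 ≤ i → i ≤ l →
      ∀ a ∈ I ^ (i - 1), x * a ∈ I ^ (i + 1) → a ∈ I ^ i) :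
    ∀ i : ℕ, 1 ≤ i → i ≤ l →
      Nonempty
        ((↥(I ^ i) ⧸ Submodule.comap (I ^ i).subtype (Ideal.span {x} * I ^ i)) ≃ₗ[R]
          ((↥(I ^ (i - 1)) ⧸ Submodule.comap (I ^ (i - 1)).subtype (I ^ i)) ×
            (↥(I ^ i) ⧸ Submodule.comap (I ^ i).subtype
              (Ideal.span {x} * I ^ (i - 1))))) := by
  intro i hi hil
  obtain ⟨n, rfl⟩ : ∃ n, i = n + 1 := ⟨i - 1, by omega⟩
  have hinj' : ∀ a ∈ I ^ n, x * a ∈ I ^ (n + 2) → a ∈ I ^ (n + 1) := hinj (n + 1) hi hil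
  rw [Nat.add_sub_cancel]
  have : Module.Free (R ⧸ I) (↥(I ^ (n + 1)) ⧸ (I • ⊤ : Submodule R ↥(I ^ (n + 1)))) :=
    hfree (n + 1) hi hil
  have : Module.Free (R ⧸ I) (↥(I ^ n) ⧸ (I • ⊤ : Submodule R ↥(I ^ n))) := by
    rcases Nat.eq_zero_or_pos n with rfl | hn
    · have : Module.Free R ↥(I ^ 0) :=
        Module.Free.of_equiv (LinearEquiv.ofTop (I ^ 0) (by simp)).symm
      exact free_quotient_smul_top I
    · exact hfree n hn (by omega)
  obtain ⟨s, hsI, hs⟩ := exists_socle_of_radical_eq_maximalIdeal hprim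
  have : Nontrivial (R ⧸ I) :=
    Ideal.Quotient.nontrivial_iff.mpr fun h => hsI (h ▸ Submodule.mem_top)
  have : IsLocalRing (R ⧸ I) :=
    IsLocalRing.of_surjective' (Ideal.Quotient.mk I) Ideal.Quotient.mk_surjective
  have hfin (k : ℕ) : Module.Finite (R ⧸ I) (↥(I ^ k) ⧸ (I • ⊤ : Submodule R ↥(I ^ k))) :=
    Module.Finite.of_restrictScalars_finite R _ _
  have hmem : ∀ a ∈ I ^ n, x * a ∈ I ^ (n + 1) := fun a ha => by
    rw [pow_succ']
    exact Ideal.mul_mem_mul hxI ha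
  let f : ↥(I ^ n) →ₗ[R] ↥(I ^ (n + 1)) := (LinearMap.mulLeft R x).restrict hmem
  have hcoe : ∀ a, (f a : R) = x * a := fun _ => rfl
  let fbar : (↥(I ^ n) ⧸ (I • ⊤ : Submodule R ↥(I ^ n))) →ₗ[R]
      (↥(I ^ (n + 1)) ⧸ (I • ⊤ : Submodule R ↥(I ^ (n + 1)))) :=
    Submodule.mapQ _ _ f (Submodule.smul_top_le_comap_smul_top I f)
  have hfbar : Function.Injective fbar := by
    rw [← LinearMap.ker_eq_bot, LinearMap.ker_eq_bot']
    intro z hz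
    obtain ⟨a, rfl⟩ := Submodule.mkQ_surjective _ z
    rw [Submodule.mkQ_apply, Submodule.mapQ_apply, Submodule.Quotient.mk_eq_zero,
      mem_smul_top_pow_iff] at hz
    rw [Submodule.mkQ_apply, Submodule.Quotient.mk_eq_zero, mem_smul_top_pow_iff]
    exact hinj' a a.2 hz
  obtain ⟨g, hg⟩ := exists_leftInverse_of_injective_of_socle (s := Ideal.Quotient.mk I s)
    (mt Ideal.Quotient.eq_zero_iff_mem.mp hsI)
    (by
      intro a ha
      obtain ⟨a, rfl⟩ := Ideal.Quotient.mk_surjective a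
      rw [← map_mul, Ideal.Quotient.eq_zero_iff_mem]
      refine hs a ?_
      rw [IsLocalRing.mem_maximalIdeal, mem_nonunits_iff] at ha ⊢
      exact fun hu => ha (hu.map _))
    (fbar.extendScalarsOfSurjective (S := R ⧸ I) Ideal.Quotient.mk_surjective) hfbar
  have hK : (I • ⊤ : Submodule R ↥(I ^ n)) = Submodule.comap (I ^ n).subtype (I ^ (n + 1)) :=
    Submodule.ext fun b => mem_smul_top_pow_iff I n b
  refine nonempty_quotient_equiv_prod _ _ _ f ?_ ?_
    ((Submodule.quotEquivOfEq _ _ hK).toLinearMap ∘ₗ g.restrictScalars R ∘ₗ Submodule.mkQ _) ?_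
  · ext b
    rw [Submodule.mem_comap, Ideal.mem_span_singleton_mul]
    constructor
    · rintro ⟨a, ha, hab⟩
      exact ⟨⟨a, Ideal.pow_le_pow_right n.le_succ ha⟩, ha, Subtype.ext hab⟩
    · rintro ⟨a, ha, rfl⟩
      exact ⟨a, ha, rfl⟩
  · ext b
    rw [Submodule.mem_comap, Ideal.mem_span_singleton_mul]
    constructor
    · rintro ⟨a, ha, hab⟩
      exact ⟨⟨a, ha⟩, Subtype.ext hab⟩
    · rintro ⟨a, rfl⟩
      exact ⟨a, a.2, rfl⟩
  · intro a
    have h := LinearMap.congr_fun hg (Submodule.Quotient.mk a)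
    change Submodule.quotEquivOfEq _ _ hK (g (fbar (Submodule.Quotient.mk a))) = _
    exact congrArg (Submodule.quotEquivOfEq _ _ hK) h
end

section
/- Let (R, m) be a commutative Noetherian local ring, let I be an m-primary ideal of R, let l > 0 be an integer, and let x ∈ I \ I² be a nonzerodivisor of R. Assume that for every 1 ≤ i ≤ l the R/I-module I^i/I^{i+1} is free and the map I^{i-1}/I^i → I^i/I^{i+1} induced by multiplication by x is injective (with the convention I^0 = R). Then for every 1 ≤ i ≤ l there is an isomorphism of R-modules (I^i + (x))/x(I^i + (x)) ≅ R/(I^i + (x)) ⊕ (I^i/xI^{i-1}). -/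
open TensorProduct in
/-- If the maximal ideal of a local ring is an associated prime of the ring, then every injective
linear map between finite free modules splits. -/
theorem LinearMap.exists_leftInverse_of_maximalIdeal_mem_associatedPrimes {A M N : Type*}
    [CommRing A] [IsNoetherianRing A] [IsLocalRing A] [AddCommGroup M] [Module A M]
    [AddCommGroup N] [Module A N] [Module.Finite A M] [Module.Free A M]
    [Module.Finite A N] [Module.Free A N]
    (hA : IsLocalRing.maximalIdeal A ∈ associatedPrimes A A)
    (f : M →ₗ[A] N) (hf : Function.Injective f) :
    ∃ g : N →ₗ[A] M, g ∘ₗ f = LinearMap.id := by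
  obtain ⟨-, s, hs⟩ := (isAssociatedPrime_iff_exists_injective_linearMap _ _).mp hA
  rw [IsLocalRing.split_injective_iff_lTensor_residueField_injective]
  change Function.Injective (f.lTensor (A ⧸ IsLocalRing.maximalIdeal A))
  have hcomm : s.rTensor N ∘ₗ f.lTensor _ = f.lTensor A ∘ₗ s.rTensor M := by
    rw [LinearMap.rTensor_comp_lTensor, LinearMap.lTensor_comp_rTensor]
  have hinj : Function.Injective (f.lTensor A ∘ₗ s.rTensor M) :=
    (Module.Flat.lTensor_preserves_injective_linearMap f hf).comp
      (Module.Flat.rTensor_preserves_injective_linearMap s hs)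
  rw [← hcomm] at hinj
  exact Function.Injective.of_comp hinj

theorem IsLocalRing.maximalIdeal_mem_associatedPrimes_quotient {R : Type*} [CommRing R]
    [IsNoetherianRing R] [IsLocalRing R] {I : Ideal R} [IsLocalRing (R ⧸ I)]
    (hI : I.radical = maximalIdeal R) :
    maximalIdeal (R ⧸ I) ∈ associatedPrimes (R ⧸ I) (R ⧸ I) := by
  obtain ⟨P, hP⟩ := associatedPrimes.nonempty (R ⧸ I) (R ⧸ I)
  have : P.IsPrime := hP.isPrime
  have hle : maximalIdeal R ≤ P.comap (Ideal.Quotient.mk I) := by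
    rw [← hI]
    refine (Ideal.IsPrime.radical_le_iff inferInstance).mpr fun a ha ↦ ?_
    rw [Ideal.mem_comap, Ideal.Quotient.eq_zero_iff_mem.mpr ha]
    exact P.zero_mem
  have hmax : maximalIdeal (R ⧸ I) ≤ P := fun a ha ↦ by
    obtain ⟨r, rfl⟩ := Ideal.Quotient.mk_surjective a
    exact hle ((mem_maximalIdeal r).mpr fun hr ↦ ha (hr.map (Ideal.Quotient.mk I)))
  rwa [hmax.antisymm (le_maximalIdeal this.ne_top)]

namespace Ideal

variable {R : Type*} [CommRing R] (I : Ideal R)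

theorem mem_smul_top_pow_iff {n : ℕ} (a : ↥(I ^ n)) :
    a ∈ (I • ⊤ : Submodule R ↥(I ^ n)) ↔ (a : R) ∈ I ^ (n + 1) := by
  rw [Submodule.mem_smul_top_iff, smul_eq_mul, pow_succ']

theorem free_pow_zero_quotient :
    Module.Free (R ⧸ I) (↥(I ^ 0) ⧸ (I • ⊤ : Submodule R ↥(I ^ 0))) := by
  let e : ↥(I ^ 0) ≃ₗ[R] R :=
    LinearEquiv.ofTop _ (by rw [pow_zero, one_eq_top])
  have he : Submodule.map (e : ↥(I ^ 0) →ₗ[R] R) (I • ⊤) = I := by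
    rw [Submodule.map_smul'', Submodule.map_top, LinearEquiv.range, smul_eq_mul, mul_top]
  exact Module.Free.of_equiv
    ((Submodule.Quotient.equiv _ _ e he).symm.extendScalarsOfSurjective
      (S := R ⧸ I) Quotient.mk_surjective)

/-- Multiplication by `x ∈ I` as a map `I ^ n → I ^ (n + 1)`. -/
def mulPow {x : R} (hx : x ∈ I) (n : ℕ) : ↥(I ^ n) →ₗ[R] ↥(I ^ (n + 1)) :=
  (LinearMap.mulLeft R x).restrict fun a ha ↦ by
    rw [pow_succ']; exact mul_mem_mul hx ha

/-- If multiplication by `x` from `I ^ n / I ^ (n + 1)` to `I ^ (n + 1) / I ^ (n + 2)` is an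
injective map of free `R / I`-modules, then division by `x` extends to a map on `I ^ (n + 1)`,
modulo any ideal containing `I ^ (n + 1)`. -/
theorem exists_linearMap_mulPow_eq_mk [IsNoetherianRing R] [IsLocalRing R]
    (hprim : I.radical = IsLocalRing.maximalIdeal R) {x : R} (hx : x ∈ I) (n : ℕ)
    (hfree : Module.Free (R ⧸ I) (↥(I ^ n) ⧸ (I • ⊤ : Submodule R ↥(I ^ n))))
    (hfree' : Module.Free (R ⧸ I) (↥(I ^ (n + 1)) ⧸ (I • ⊤ : Submodule R ↥(I ^ (n + 1)))))
    (hinj : ∀ a ∈ I ^ n, x * a ∈ I ^ (n + 2) → a ∈ I ^ (n + 1))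
    {J : Ideal R} (hJ : I ^ (n + 1) ≤ J) :
    ∃ f : ↥(I ^ (n + 1)) →ₗ[R] R ⧸ J, ∀ a : ↥(I ^ n), f (I.mulPow hx n a) = Quotient.mk J a := by
  have hI : I ≠ ⊤ := by
    rintro rfl
    exact Ideal.IsPrime.ne_top' (hprim.symm.trans (radical_top R))
  have : Nontrivial (R ⧸ I) := Quotient.nontrivial_iff.mpr hI
  have : IsLocalRing (R ⧸ I) := .of_surjective' (Quotient.mk I) Quotient.mk_surjective
  let μ : (↥(I ^ n) ⧸ (I • ⊤ : Submodule R ↥(I ^ n))) →ₗ[R]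
      (↥(I ^ (n + 1)) ⧸ (I • ⊤ : Submodule R ↥(I ^ (n + 1)))) :=
    Submodule.mapQ _ _ (I.mulPow hx n) fun a ha ↦ by
      rw [mem_smul_top_pow_iff] at ha
      rw [Submodule.mem_comap, mem_smul_top_pow_iff, pow_succ']
      exact mul_mem_mul hx ha
  have hμ : Function.Injective μ := by
    refine (injective_iff_map_eq_zero μ).mpr fun z hz ↦ ?_
    obtain ⟨a, rfl⟩ := Submodule.Quotient.mk_surjective _ z
    rw [Submodule.mapQ_apply, Submodule.Quotient.mk_eq_zero, mem_smul_top_pow_iff] at hz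
    rw [Submodule.Quotient.mk_eq_zero, mem_smul_top_pow_iff]
    exact hinj a a.2 hz
  have : Module.Finite (R ⧸ I) (↥(I ^ n) ⧸ (I • ⊤ : Submodule R ↥(I ^ n))) :=
    .of_restrictScalars_finite R _ _
  have : Module.Finite (R ⧸ I) (↥(I ^ (n + 1)) ⧸ (I • ⊤ : Submodule R ↥(I ^ (n + 1)))) :=
    .of_restrictScalars_finite R _ _
  obtain ⟨ρ, hρ⟩ := LinearMap.exists_leftInverse_of_maximalIdeal_mem_associatedPrimes
    (IsLocalRing.maximalIdeal_mem_associatedPrimes_quotient hprim)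
    (μ.extendScalarsOfSurjective (S := R ⧸ I) Quotient.mk_surjective) hμ
  let ι : (↥(I ^ n) ⧸ (I • ⊤ : Submodule R ↥(I ^ n))) →ₗ[R] R ⧸ J :=
    Submodule.mapQ _ J (I ^ n).subtype fun a ha ↦ hJ ((I.mem_smul_top_pow_iff a).mp ha)
  refine ⟨ι ∘ₗ ρ.restrictScalars R ∘ₗ Submodule.mkQ _, fun a ↦ ?_⟩
  exact congrArg ι (LinearMap.congr_fun hρ (Submodule.Quotient.mk a))

/-- The ideal `I ^ (n + 1)` meets `(x)` in `x I ^ n` if multiplication by `x` is injective on the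
associated graded ring in degrees below `n`. -/
theorem mem_pow_of_mul_mem_pow {x : R} {n : ℕ}
    (hinj : ∀ i < n, ∀ a ∈ I ^ i, x * a ∈ I ^ (i + 2) → a ∈ I ^ (i + 1))
    {a : R} (ha : x * a ∈ I ^ (n + 1)) : a ∈ I ^ n := by
  induction n with
  | zero => simp
  | succ n ih =>
    exact hinj n n.lt_succ_self a
      (ih (fun i hi ↦ hinj i (hi.trans n.lt_succ_self)) (pow_le_pow_right (Nat.le_succ _) ha)) ha

end Ideal

/-- The targets of two surjective linear maps with the same kernel are isomorphic. -/
theorem LinearMap.nonempty_linearEquiv_of_ker_eq {R P M N : Type*} [Ring R] [AddCommGroup P]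
    [AddCommGroup M] [AddCommGroup N] [Module R P] [Module R M] [Module R N]
    {f : P →ₗ[R] M} {g : P →ₗ[R] N} (hf : Function.Surjective f) (hg : Function.Surjective g)
    (h : LinearMap.ker f = LinearMap.ker g) : Nonempty (M ≃ₗ[R] N) :=
  ⟨(f.quotKerEquivOfSurjective hf).symm ≪≫ₗ Submodule.quotEquivOfEq _ _ h ≪≫ₗ
    g.quotKerEquivOfSurjective hg⟩

/-- Lemma 2.3(5) of the paper.
Let `(R, m)` be a commutative Noetherian local ring, `I` an `m`-primary ideal,
`l > 0`, and `x ∈ I \ I²` a nonzerodivisor of `R`.  Assume that for every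
`1 ≤ i ≤ l` the `R/I`-module `Iⁱ/Iⁱ⁺¹` is free and the map
`Iⁱ⁻¹/Iⁱ → Iⁱ/Iⁱ⁺¹` induced by multiplication by `x` is injective
(elementwise: `a ∈ Iⁱ⁻¹` with `x·a ∈ Iⁱ⁺¹` implies `a ∈ Iⁱ`).
Then for every `1 ≤ i ≤ l` there is an isomorphism of `R`-modules
`(Iⁱ + (x))/x·(Iⁱ + (x)) ≅ R/(Iⁱ + (x)) ⊕ (Iⁱ/x·Iⁱ⁻¹)`. -/
theorem stmt4 {R : Type*} [CommRing R] [IsNoetherianRing R] [IsLocalRing R]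
    (I : Ideal R) (hprim : I.radical = IsLocalRing.maximalIdeal R)
    (l : ℕ) (hl : 0 < l)
    (x : R) (hxI : x ∈ I) (hxI2 : x ∉ I ^ 2) (hx : x ∈ nonZeroDivisors R)
    (hfree : ∀ i : ℕ, 1 ≤ i → i ≤ l →
      Module.Free (R ⧸ I) (↥(I ^ i) ⧸ (I • ⊤ : Submodule R ↥(I ^ i))))
    (hinj : ∀ i : ℕ, 1 ≤ i → i ≤ l →
      ∀ a ∈ I ^ (i - 1), x * a ∈ I ^ (i + 1) → a ∈ I ^ i) :
    ∀ i : ℕ, 1 ≤ i → i ≤ l →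
      Nonempty
        ((↥(I ^ i ⊔ Ideal.span {x}) ⧸
            Submodule.comap (I ^ i ⊔ Ideal.span {x}).subtype
              (Ideal.span {x} * (I ^ i ⊔ Ideal.span {x}))) ≃ₗ[R]
          ((R ⧸ (I ^ i ⊔ Ideal.span {x})) ×
            (↥(I ^ i) ⧸ Submodule.comap (I ^ i).subtype
              (Ideal.span {x} * I ^ (i - 1))))) := by
  rintro (_ | n) hi hil
  · omega
  have hxpow (j : ℕ) (hj : j < l) : ∀ a ∈ I ^ j, x * a ∈ I ^ (j + 2) → a ∈ I ^ (j + 1) :=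
    hinj (j + 1) (by omega) (by omega)
  set J := I ^ (n + 1) ⊔ Ideal.span {x}
  have hIJ : I ^ (n + 1) ≤ J := le_sup_left
  have hxJ : x ∈ J := le_sup_right (a := I ^ (n + 1)) (Ideal.mem_span_singleton_self x)
  have hfreen : Module.Free (R ⧸ I) (↥(I ^ n) ⧸ (I • ⊤ : Submodule R ↥(I ^ n))) := by
    rcases n with _ | n
    · exact I.free_pow_zero_quotient
    · exact hfree (n + 1) (by omega) (by omega)
  obtain ⟨f, hf⟩ := I.exists_linearMap_mulPow_eq_mk hprim hxI n hfreen
    (hfree (n + 1) hi hil) (hxpow n (by omega)) hIJ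
  let q : ↥(I ^ (n + 1)) × R →ₗ[R] ↥J :=
    (Submodule.inclusion hIJ).coprod (LinearMap.toSpanSingleton R ↥J ⟨x, hxJ⟩)
  have hq (p : ↥(I ^ (n + 1)) × R) : (q p : R) = p.1 + p.2 * x := rfl
  have hqs : Function.Surjective q := by
    rintro ⟨b, hb⟩
    obtain ⟨y, hy, z, hz, rfl⟩ := Submodule.mem_sup.mp hb
    obtain ⟨r, rfl⟩ := Ideal.mem_span_singleton'.mp hz
    exact ⟨(⟨y, hy⟩, r), rfl⟩
  let K : Submodule R ↥(I ^ (n + 1)) :=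
    Submodule.comap (I ^ (n + 1)).subtype (Ideal.span {x} * I ^ n)
  let ψ : ↥(I ^ (n + 1)) × R →ₗ[R] (R ⧸ J) × (↥(I ^ (n + 1)) ⧸ K) :=
    (f.coprod (Submodule.mkQ J)).prod (K.mkQ ∘ₗ LinearMap.fst R _ _)
  have hψs : Function.Surjective ψ := by
    rintro ⟨c, d⟩
    obtain ⟨y, rfl⟩ := K.mkQ_surjective d
    obtain ⟨r, hr⟩ := Submodule.mkQ_surjective J (c - f y)
    exact ⟨(y, r), Prod.ext (by simp [ψ, hr]) rfl⟩
  refine LinearMap.nonempty_linearEquiv_of_ker_eq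
    (f := Submodule.mkQ _ ∘ₗ q) ((Submodule.mkQ_surjective _).comp hqs) hψs ?_
  ext ⟨y, r⟩
  have hleft : (y, r) ∈ LinearMap.ker (Submodule.mkQ
      (Submodule.comap J.subtype (Ideal.span {x} * J)) ∘ₗ q) ↔
      ∃ c ∈ J, x * c = y + r * x := by
    rw [LinearMap.mem_ker, LinearMap.comp_apply, Submodule.mkQ_apply,
      Submodule.Quotient.mk_eq_zero, Submodule.mem_comap, Submodule.subtype_apply, hq,
      Ideal.mem_span_singleton_mul]
  have hright : (y, r) ∈ LinearMap.ker ψ ↔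
      f y + Ideal.Quotient.mk J r = 0 ∧ ∃ a ∈ I ^ n, x * a = y := by
    rw [LinearMap.mem_ker, Prod.ext_iff]
    refine and_congr Iff.rfl ?_
    rw [← Ideal.mem_span_singleton_mul]
    exact Submodule.Quotient.mk_eq_zero K
  have hfy {a : R} (ha : a ∈ I ^ n) (hay : x * a = y) : f y = Ideal.Quotient.mk J a := by
    rw [← hf ⟨a, ha⟩]
    exact congrArg f (Subtype.ext hay.symm)
  rw [hleft, hright]
  constructor
  · rintro ⟨c, hc, hcy⟩
    have hy : x * (c - r) = y := by linear_combination hcy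
    have hmem : c - r ∈ I ^ n := I.mem_pow_of_mul_mem_pow
      (fun j hj ↦ hxpow j (by omega)) (by rw [hy]; exact y.2)
    refine ⟨?_, c - r, hmem, hy⟩
    rw [hfy hmem hy, ← map_add, sub_add_cancel, Ideal.Quotient.eq_zero_iff_mem]
    exact hc
  · rintro ⟨h, a, ha, hay⟩
    rw [hfy ha hay, ← map_add, Ideal.Quotient.eq_zero_iff_mem] at h
    exact ⟨a + r, h, by linear_combination hay⟩
end

section
/- Let (R, m) be a commutative Noetherian local ring of Krull dimension d ≥ 1, and let I be an m-primary ideal of R. Suppose there exist elements x₁, …, x_d ∈ I forming a regular sequence on R such that, with Q = (x₁, …, x_d), one has I² = QI, and suppose that I/I² is a free R/I-module. Then for every integer l ≥ 1 there exists an integer s ≥ 0 and an isomorphism of R-modules I^l/Q^l ≅ (I/Q)^{⊕s}. -/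
open MvPolynomial in
/-- Membership in `J * (x_i : i ∈ S) ^ n` is witnessed by a form of degree `n` in the variables
of `S` with coefficients in `J`. -/
theorem Ideal.exists_isHomogeneous_of_mem_mul_span_image_pow {σ R : Type*} [CommRing R]
    {x : σ → R} {S : Set σ} {J : Ideal R} {n : ℕ} {a : R}
    (ha : a ∈ J * Ideal.span (x '' S) ^ n) :
    ∃ F : MvPolynomial σ R, F.IsHomogeneous n ∧ F ∈ supported R S ∧
      F ∈ J.map (C : R →+* MvPolynomial σ R) ∧ eval x F = a := by
  induction ha using Submodule.mul_induction_on' with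
  | mem_mul_mem c hc b hb =>
    rw [show x '' S = Set.range (fun i : S => x i) by ext; simp,
      Ideal.mem_span_pow_iff_exists_isHomogeneous] at hb
    obtain ⟨p, hp, rfl⟩ := hb
    refine ⟨C c * rename (↑) p, (hp.rename_isHomogeneous).C_mul c,
      mul_mem (Subalgebra.algebraMap_mem _ c) ?_,
      Ideal.mul_mem_right _ _ (Ideal.mem_map_of_mem _ hc), ?_⟩
    · rw [supported_eq_range_rename]
      exact ⟨p, rfl⟩
    · rw [map_mul, eval_C, eval_rename]
      rfl
  | add a _ b _ iha ihb =>
    obtain ⟨F, hF, hFS, hFJ, rfl⟩ := iha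
    obtain ⟨G, hG, hGS, hGJ, rfl⟩ := ihb
    exact ⟨F + G, hF.add hG, add_mem hFS hGS, add_mem hFJ hGJ, map_add _ _ _⟩

open MvPolynomial in
theorem MvPolynomial.IsHomogeneous.eval_mem_mul_span_image_pow {σ R : Type*} [CommRing R]
    {x : σ → R} {S : Set σ} {J : Ideal R} {n : ℕ} {F : MvPolynomial σ R}
    (hF : F.IsHomogeneous n) (hFS : F ∈ supported R S)
    (hFJ : F ∈ J.map (C : R →+* MvPolynomial σ R)) :
    eval x F ∈ J * Ideal.span (x '' S) ^ n := by
  rw [eval_eq]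
  refine sum_mem fun m hm => Ideal.mul_mem_mul (mem_map_C_iff.mp hFJ m) ?_
  have hn : m.degree = n := by
    by_contra h
    exact mem_support_iff.mp hm (hF.coeff_eq_zero h)
  rw [← hn, Finsupp.degree_apply, ← Finset.prod_pow_eq_pow_sum]
  refine Ideal.prod_mem_prod fun i hi => Ideal.pow_mem_pow (Ideal.subset_span ?_) _
  exact ⟨i, mem_supported.mp hFS ((mem_vars_iff_mem_support i).mpr ⟨m, hm, hi⟩), rfl⟩

open MvPolynomial in
/-- The elements `x i`, `i ∈ S`, are quasi-regular: any form of degree `n` in the variables of `S`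
whose value at `x` lies in `(x_i : i ∈ S) ^ (n + 1)` has all its coefficients
in `(x_i : i ∈ S)`. -/
def IsQuasiRegularOn {σ R : Type*} [CommRing R] (x : σ → R) (S : Set σ) : Prop :=
  ∀ ⦃n : ℕ⦄ ⦃F : MvPolynomial σ R⦄, F.IsHomogeneous n → F ∈ supported R S →
    eval x F ∈ Ideal.span (x '' S) ^ (n + 1) → F ∈ (Ideal.span (x '' S)).map C

namespace IsQuasiRegularOn

open MvPolynomial

variable {σ R : Type*} [CommRing R] {x : σ → R} {S : Set σ}

theorem mem_map_C_of_eval_eq_zero {n : ℕ}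
    (h : ∀ F : MvPolynomial σ R, F.IsHomogeneous n → F ∈ supported R S →
      eval x F = 0 → F ∈ (Ideal.span (x '' S)).map C)
    {F : MvPolynomial σ R} (hF : F.IsHomogeneous n) (hFS : F ∈ supported R S)
    (hx : eval x F ∈ Ideal.span (x '' S) ^ (n + 1)) :
    F ∈ (Ideal.span (x '' S)).map C := by
  rw [pow_succ'] at hx
  obtain ⟨G, hG, hGS, hGJ, hGx⟩ := Ideal.exists_isHomogeneous_of_mem_mul_span_image_pow hx
  have := h (F - G) (hF.sub hG) (sub_mem hFS hGS) (by rw [map_sub, hGx, sub_self])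
  simpa using add_mem this hGJ

theorem of_eval_eq_zero
    (h : ∀ (n : ℕ) (F : MvPolynomial σ R), F.IsHomogeneous n → F ∈ supported R S →
      eval x F = 0 → F ∈ (Ideal.span (x '' S)).map C) :
    IsQuasiRegularOn x S :=
  fun n _ => mem_map_C_of_eval_eq_zero (h n)

theorem eq_zero_of_isHomogeneous_zero {F : MvPolynomial σ R} (hF : F.IsHomogeneous 0)
    (hx : eval x F = 0) : F = 0 := by
  rw [← totalDegree_zero_iff_isHomogeneous, totalDegree_eq_zero_iff_eq_C] at hF
  rw [hF, eval_C] at hx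
  rw [hF, hx, C_0]

theorem empty : IsQuasiRegularOn x ∅ := by
  refine of_eval_eq_zero fun n F hF hFS hx => ?_
  rw [supported_empty] at hFS
  obtain ⟨c, rfl⟩ := hFS
  replace hx : c = 0 := by simpa using hx
  simp [hx]

/-- An element regular modulo the ideal of a quasi-regular family is regular modulo its powers. -/
theorem mem_pow_of_mul_mem_pow (h : IsQuasiRegularOn x S) {y : R}
    (hy : ∀ a, y * a ∈ Ideal.span (x '' S) → a ∈ Ideal.span (x '' S)) (n : ℕ) {a : R}
    (ha : y * a ∈ Ideal.span (x '' S) ^ n) : a ∈ Ideal.span (x '' S) ^ n := by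
  induction n with
  | zero => simp
  | succ n ih =>
    have ha' := ih (Ideal.pow_le_pow_right n.le_succ ha)
    rw [← one_mul (_ ^ n), Ideal.one_eq_top] at ha'
    obtain ⟨F, hF, hFS, -, rfl⟩ := Ideal.exists_isHomogeneous_of_mem_mul_span_image_pow ha'
    have key := h (hF.C_mul y) (mul_mem (Subalgebra.algebraMap_mem _ y) hFS) (by simpa using ha)
    rw [pow_succ']
    refine hF.eval_mem_mul_span_image_pow hFS (mem_map_C_iff.mpr fun m => hy _ ?_)
    simpa using mem_map_C_iff.mp key m

theorem insert (h : IsQuasiRegularOn x S) {k : σ}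
    (hk : ∀ a, x k * a ∈ Ideal.span (x '' S) → a ∈ Ideal.span (x '' S)) :
    IsQuasiRegularOn x (insert k S) := by
  have hle : Ideal.span (x '' S) ≤ Ideal.span (x '' (Insert.insert k S)) :=
    Ideal.span_mono (Set.image_mono (Set.subset_insert k S))
  refine of_eval_eq_zero fun n => ?_
  induction n with
  | zero =>
    intro F hF _ hx
    rw [eq_zero_of_isHomogeneous_zero hF hx]
    exact zero_mem _
  | succ n ih =>
    intro F hF hFS hx
    set H := F.divMonomial (Finsupp.single k 1) with hH
    set G := F.modMonomial (Finsupp.single k 1) with hG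
    have hFHG : X k * H + G = F := divMonomial_add_modMonomial_single F k
    have hHhom : H.IsHomogeneous n := by
      intro m hm
      rw [hH, coeff_divMonomial] at hm
      have := hF hm
      rw [Pi.one_def, ← Finsupp.degree_eq_weight_one] at this ⊢
      simp only [map_add, Finsupp.degree_single] at this
      omega
    have hGcoeff : ∀ m, coeff m G ≠ 0 → coeff m F ≠ 0 ∧ m k = 0 := by
      intro m hm
      by_cases hmk : Finsupp.single k 1 ≤ m
      · exact absurd (coeff_modMonomial_of_le F hmk) hm
      · rw [hG, coeff_modMonomial_of_not_le F hmk] at hm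
        exact ⟨hm, by simpa using hmk⟩
    have hGhom : G.IsHomogeneous (n + 1) := fun m hm => hF (hGcoeff m hm).1
    have hFvars := mem_supported.mp hFS
    have hHS : H ∈ supported R (Insert.insert k S) := by
      refine mem_supported.mpr fun i hi => ?_
      obtain ⟨m, hm, him⟩ := (mem_vars_iff_mem_support i).mp hi
      rw [mem_support_iff, hH, coeff_divMonomial] at hm
      refine hFvars ((mem_vars_iff_mem_support i).mpr ⟨_, mem_support_iff.mpr hm, ?_⟩)
      rw [Finsupp.mem_support_iff] at him ⊢
      rw [Finsupp.add_apply]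
      omega
    have hGS : G ∈ supported R S := by
      refine mem_supported.mpr fun i hi => ?_
      obtain ⟨m, hm, him⟩ := (mem_vars_iff_mem_support i).mp hi
      obtain ⟨hm, hmk⟩ := hGcoeff m (mem_support_iff.mp hm)
      refine (hFvars ((mem_vars_iff_mem_support i).mpr
        ⟨m, mem_support_iff.mpr hm, him⟩)).resolve_left ?_
      rintro rfl
      exact Finsupp.mem_support_iff.mp him hmk
    have hsum : x k * eval x H + eval x G = 0 := by
      rw [← hx, ← hFHG, map_add, map_mul, eval_X]
    have hGx : eval x G ∈ Ideal.span (x '' S) ^ (n + 1) := by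
      have := hGhom.eval_mem_mul_span_image_pow (x := x) (J := ⊤) hGS
        (mem_map_C_iff.mpr fun _ => Submodule.mem_top)
      rwa [← Ideal.one_eq_top, one_mul] at this
    have hHx : eval x H ∈ Ideal.span (x '' S) ^ (n + 1) := by
      refine h.mem_pow_of_mul_mem_pow hk _ ?_
      rw [eq_neg_of_add_eq_zero_left hsum]
      exact neg_mem hGx
    have hHJ := mem_map_C_of_eval_eq_zero ih hHhom hHS (Ideal.pow_right_mono hle _ hHx)
    rw [← one_mul (_ ^ (n + 1)), Ideal.one_eq_top] at hHx
    obtain ⟨H', hH', hHS', -, hHx'⟩ := Ideal.exists_isHomogeneous_of_mem_mul_span_image_pow hHx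
    have key : G + C (x k) * H' ∈ (Ideal.span (x '' S)).map C := by
      refine h (hGhom.add (hH'.C_mul _))
        (add_mem hGS (mul_mem (Subalgebra.algebraMap_mem _ _) hHS')) ?_
      rw [map_add, map_mul, eval_C, hHx', add_comm (eval x G), hsum]
      exact zero_mem _
    have hkmem : x k ∈ Ideal.span (x '' (Insert.insert k S)) :=
      Ideal.subset_span ⟨k, Set.mem_insert k S, rfl⟩
    have hGJ : G ∈ (Ideal.span (x '' (Insert.insert k S))).map C := by
      have := sub_mem (Ideal.map_mono hle key)
        (Ideal.mul_mem_right H' _ (Ideal.mem_map_of_mem (C : R →+* MvPolynomial σ R) hkmem))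
      rwa [add_sub_cancel_right] at this
    rw [← hFHG]
    exact add_mem (Ideal.mul_mem_left _ _ hHJ) hGJ

end IsQuasiRegularOn

/-- A weakly regular sequence is quasi-regular. -/
theorem RingTheory.Sequence.IsWeaklyRegular.isQuasiRegularOn_univ {R : Type*} [CommRing R] {d : ℕ}
    {x : Fin d → R} (h : RingTheory.Sequence.IsWeaklyRegular R (List.ofFn x)) :
    IsQuasiRegularOn x Set.univ := by
  have main : ∀ k ≤ d, IsQuasiRegularOn x {i | i.val < k} := by
    intro k hkd
    induction k with
    | zero => simpa using IsQuasiRegularOn.empty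
    | succ k ih =>
      have hins : {i : Fin d | i.val < k + 1} = insert ⟨k, hkd⟩ {i | i.val < k} := by
        ext i
        simp only [Set.mem_ofPred_eq, Set.mem_insert_iff, Fin.ext_iff]
        omega
      rw [hins]
      refine (ih (by omega)).insert fun a ha => ?_
      have hspan : (Ideal.ofList ((List.ofFn x).take k) • ⊤ : Submodule R R) =
          Ideal.span (x '' {i | i.val < k}) := by
        rw [smul_eq_mul, Ideal.mul_top, Ideal.ofList]
        congr 1
        ext r
        simp only [Set.mem_ofPred_eq, List.mem_take_iff_getElem, List.getElem_ofFn, List.length_ofFn,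
          Set.mem_image]
        constructor
        · rintro ⟨i, hi, rfl⟩
          exact ⟨⟨i, by omega⟩, by simp; omega, rfl⟩
        · rintro ⟨i, hi, rfl⟩
          exact ⟨i, by omega, rfl⟩
      have hreg := h.regular_mod_prev k (by simpa using hkd)
      rw [hspan, List.getElem_ofFn] at hreg
      exact mem_of_isSMulRegular_quotient_of_smul_mem hreg ha
  convert main d le_rfl
  ext i
  simp

theorem Ideal.pow_eq_mul_pow_of_sq_eq_mul {R : Type*} [CommRing R] {I Q : Ideal R}
    (h : I ^ 2 = Q * I) (n : ℕ) : I ^ (n + 1) = I * Q ^ n := by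
  induction n with
  | zero => simp
  | succ n ih => rw [pow_succ, ih, mul_right_comm, ← sq, h, mul_right_comm, ← pow_succ', mul_comm]

open MvPolynomial in
/-- If `x` is quasi-regular and `Q = (x)`, then `I * Q ^ n / Q ^ (n + 1)` is a direct sum of
copies of `I / Q`, indexed by the monomials of degree `n`. -/
theorem IsQuasiRegularOn.nonempty_linearEquiv {σ R : Type*} [CommRing R] [Fintype σ]
    [DecidableEq σ] {x : σ → R} (hx : IsQuasiRegularOn x Set.univ) {I K : Ideal R}
    (n : ℕ) (hK : K = I * Ideal.span (Set.range x) ^ n) :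
    Nonempty ((↥K ⧸ Submodule.comap K.subtype (Ideal.span (Set.range x) ^ (n + 1))) ≃ₗ[R]
      (Finset.finsuppAntidiag (Finset.univ : Finset σ) n →
        ↥I ⧸ Submodule.comap I.subtype (Ideal.span (Set.range x)))) := by
  have hmem (m : σ →₀ ℕ) : m ∈ Finset.finsuppAntidiag Finset.univ n ↔ m.degree = n := by
    simp [Finset.mem_finsuppAntidiag, Finsupp.degree_eq_sum]
  set ι := Finset.finsuppAntidiag (Finset.univ : Finset σ) n
  rw [← Set.image_univ] at hK ⊢
  set Q := Ideal.span (x '' Set.univ)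
  let form (a : ι → I) : MvPolynomial σ R := ∑ m, monomial m.1 (a m : R)
  have hsupp (F : MvPolynomial σ R) : F ∈ supported R Set.univ := by simp
  have hform (a : ι → I) : (form a).IsHomogeneous n :=
    IsHomogeneous.sum _ _ _ fun m _ => isHomogeneous_monomial _ ((hmem m).mp m.2)
  have hformI (a : ι → I) : form a ∈ I.map (C : R →+* MvPolynomial σ R) := by
    refine sum_mem fun m _ => mem_map_C_iff.mpr fun m' => ?_
    rw [coeff_monomial]
    split_ifs
    exacts [(a m).2, zero_mem _]
  have hcoeff (a : ι → I) (m : ι) : coeff m.1 (form a) = a m := by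
    simp [form, coeff_sum, coeff_monomial]
  let f : (ι → I) →ₗ[R] K := LinearMap.codRestrict K
    { toFun a := eval x (form a)
      map_add' a b := by simp [form, Finset.sum_add_distrib]
      map_smul' r a := by simp [form, Finset.mul_sum, eval_monomial, mul_assoc] }
    fun a => hK ▸ (hform a).eval_mem_mul_span_image_pow (hsupp _) (hformI a)
  have hf (a : ι → I) : (f a : R) = eval x (form a) := rfl
  let P := Submodule.comap K.subtype (Q ^ (n + 1))
  have hsurj : Function.Surjective (P.mkQ ∘ₗ f) := by
    refine (Submodule.mkQ_surjective P).comp ?_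
    rintro ⟨b, hb⟩
    rw [hK] at hb
    obtain ⟨F, hF, -, hFI, rfl⟩ := Ideal.exists_isHomogeneous_of_mem_mul_span_image_pow hb
    let a : ι → I := fun m => ⟨coeff m.1 F, mem_map_C_iff.mp hFI _⟩
    refine ⟨a, Subtype.ext ?_⟩
    rw [hf]
    congr 1
    ext m
    by_cases hm : m.degree = n
    · exact hcoeff a ⟨m, (hmem m).mpr hm⟩
    · rw [(hform a).coeff_eq_zero hm, hF.coeff_eq_zero hm]
  have hker : LinearMap.ker (P.mkQ ∘ₗ f) =
      Submodule.pi Set.univ fun _ : ι => Submodule.comap I.subtype Q := by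
    ext a
    rw [LinearMap.mem_ker, LinearMap.comp_apply, Submodule.mkQ_apply,
      Submodule.Quotient.mk_eq_zero, Submodule.mem_pi, Submodule.mem_comap]
    change eval x (form a) ∈ Q ^ (n + 1) ↔ ∀ m ∈ Set.univ, (a m : R) ∈ Q
    constructor
    · intro ha m _
      rw [← hcoeff]
      exact mem_map_C_iff.mp (hx (hform a) (hsupp _) ha) m
    · intro ha
      rw [pow_succ']
      refine (hform a).eval_mem_mul_span_image_pow (hsupp _) (sum_mem fun m _ => ?_)
      rw [← mul_one (a m : R), ← C_mul_monomial]
      exact Ideal.mul_mem_right _ _ (Ideal.mem_map_of_mem _ (ha m trivial))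
  exact ⟨((Submodule.quotEquivOfEq _ _ hker).symm.trans
    ((P.mkQ ∘ₗ f).quotKerEquivOfSurjective hsurj)).symm.trans (Submodule.quotientPi _)⟩

/-- an intermediate claim in the proof of Proposition 3.2 of
the paper.  Let `(R, m)` be a commutative Noetherian local ring of Krull
dimension `d ≥ 1` and `I` an `m`-primary ideal.  Suppose `x₁, …, x_d ∈ I`
form a regular sequence on `R` such that, with `Q = (x₁, …, x_d)`, one has
`I² = Q·I`, and suppose `I/I²` is a free `R/I`-module.  Then for every
`l ≥ 1` there exist `s ≥ 0` and an isomorphism of `R`-modules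
`Iˡ/Qˡ ≅ (I/Q)^⊕s`. -/
theorem stmt8 {R : Type*} [CommRing R] [IsNoetherianRing R] [IsLocalRing R]
    (d : ℕ) (hd : 1 ≤ d) (hdim : ringKrullDim R = d)
    (I : Ideal R) (hprim : I.radical = IsLocalRing.maximalIdeal R)
    (x : Fin d → R) (hxI : ∀ i, x i ∈ I)
    (hreg : RingTheory.Sequence.IsRegular R (List.ofFn x))
    (hred : I ^ 2 = Ideal.span (Set.range x) * I)
    (hfree : Module.Free (R ⧸ I) (↥I ⧸ (I • ⊤ : Submodule R ↥I))) :
    ∀ l : ℕ, 1 ≤ l → ∃ s : ℕ,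
      Nonempty
        ((↥(I ^ l) ⧸
            Submodule.comap (I ^ l).subtype (Ideal.span (Set.range x) ^ l)) ≃ₗ[R]
          (Fin s → (↥I ⧸ Submodule.comap I.subtype (Ideal.span (Set.range x))))) := by
  intro l hl
  obtain ⟨n, rfl⟩ := Nat.exists_eq_add_of_le' hl
  obtain ⟨e⟩ := hreg.toIsWeaklyRegular.isQuasiRegularOn_univ.nonempty_linearEquiv n
    (Ideal.pow_eq_mul_pow_of_sq_eq_mul hred n)
  exact ⟨_, ⟨e.trans (LinearEquiv.funCongrLeft R _ (Finset.equivFin _).symm)⟩⟩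
end
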